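/- In the CQ setting described in the context with r ≥ 2, write U_{n,0} := I and U_{n,i} x := α_{n,i} (T_i (U_{n,i-1} x)) ⊕ (1-α_{n,i}) x for i = 1,…,r, and fix z ∈ F. Setting ε_n := d(T_r U_{n,r-1} x_n, x_n) and δ_n := d(T_{r-1} U_{n,r-2} x_n, x_n), the following inequality holds for every n: cos d(x_n,z) · sin δ_n ≥ cos ε_n · cos d(x_n,z) · [sin(α_{n,r-1} δ_n) + sin((1-α_{n,r-1}) δ_n)] − sin ε_n · sin d(T_r U_{n,r-1} x_n, z) · sin δ_n. -/

import Mathlib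

open Filter Topology

noncomputable section

open scoped Classical

/-- The spherical metric on the unit sphere of a real Hilbert space:
`d(x,y) = arccos ⟨x,y⟩`. -/
def sphDist {H : Type*} [NormedAddCommGroup H] [InnerProductSpace ℝ H]
    (x y : H) : ℝ :=
  Real.arccos (@inner ℝ H _ x y)

/-- The geodesic combination `t x ⊕ (1-t) y` on the unit sphere:
for `x ≠ y` it is `(sin(tθ)/sin θ) • x + (sin((1-t)θ)/sin θ) • y` with `θ = d(x,y)`,
and `t x ⊕ (1-t) x = x`. -/
def geo {H : Type*} [NormedAddCommGroup H] [InnerProductSpace ℝ H]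
    (t : ℝ) (x y : H) : H :=
  if x = y then x
  else (Real.sin (t * sphDist x y) / Real.sin (sphDist x y)) • x +
    (Real.sin ((1 - t) * sphDist x y) / Real.sin (sphDist x y)) • y

/-- Convexity of a subset of the unit sphere with respect to geodesic combinations. -/
def SphConvex {H : Type*} [NormedAddCommGroup H] [InnerProductSpace ℝ H]
    (C : Set H) : Prop :=
  ∀ v ∈ C, ∀ v' ∈ C, ∀ t ∈ Set.Icc (0 : ℝ) 1, geo t v v' ∈ C

/-- The mappings `U_i` generating the `W`-mapping: `U_0 = I`,
`U_i x = α_i (T_i (U_{i-1} x)) ⊕ (1 - α_i) x`.  The `W`-mapping generated by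
`T_1, …, T_r` and `α_1, …, α_r` is `W = Uiter T α r`. -/
def Uiter {H : Type*} [NormedAddCommGroup H] [InnerProductSpace ℝ H]
    (T : ℕ → H → H) (α : ℕ → ℝ) : ℕ → H → H
  | 0 => id
  | (i + 1) => fun x => geo (α (i + 1)) (T (i + 1) (Uiter T α i x)) x

theorem cos_sphDist {H : Type*} [NormedAddCommGroup H] [InnerProductSpace ℝ H]
    {u v : H} (hu : ‖u‖ = 1) (hv : ‖v‖ = 1) :
    Real.cos (sphDist u v) = inner ℝ u v := by
  have h := abs_real_inner_le_norm u v
  rw [hu, hv, one_mul, abs_le] at h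
  exact Real.cos_arccos h.1 h.2

theorem sphDist_triangle_cos {H : Type*} [NormedAddCommGroup H] [InnerProductSpace ℝ H]
    {p x z : H} (hp : ‖p‖ = 1) (hx : ‖x‖ = 1) (hz : ‖z‖ = 1) :
    Real.cos (sphDist p x) * Real.cos (sphDist p z)
      - Real.sin (sphDist p x) * Real.sin (sphDist p z) ≤ Real.cos (sphDist x z) := by
  rw [cos_sphDist hp hx, cos_sphDist hp hz, cos_sphDist hx hz]
  have key : ∀ w : H, ‖w‖ = 1 →
      Real.sin (sphDist p w) = ‖w - (inner ℝ p w : ℝ) • p‖ := by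
    intro w hw
    unfold sphDist
    rw [Real.sin_arccos, ← Real.sqrt_sq (norm_nonneg (w - (inner ℝ p w : ℝ) • p))]
    congr 1
    rw [← real_inner_self_eq_norm_sq]
    simp only [inner_sub_left, inner_sub_right, real_inner_smul_left, real_inner_smul_right,
      real_inner_self_eq_norm_sq, norm_smul, mul_pow, Real.norm_eq_abs, sq_abs, hp, hw,
      real_inner_comm p w]
    ring
  rw [key x hx, key z hz]
  have h := abs_real_inner_le_norm (x - (inner ℝ p x : ℝ) • p) (z - (inner ℝ p z : ℝ) • p)
  have h2 := (abs_le.mp h).1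
  have h3 : inner ℝ (x - (inner ℝ p x : ℝ) • p) (z - (inner ℝ p z : ℝ) • p)
      = inner ℝ x z - inner ℝ p x * inner ℝ p z := by
    simp only [inner_sub_left, inner_sub_right, real_inner_smul_left, real_inner_smul_right,
      real_inner_self_eq_norm_sq, hp, real_inner_comm p x]
    ring
  linarith

theorem geo_inner {H : Type*} [NormedAddCommGroup H] [InnerProductSpace ℝ H]
    {q x z : H} (t : ℝ) (hne : q ≠ x) (hs : Real.sin (sphDist q x) ≠ 0) :
    inner ℝ (geo t q x) z * Real.sin (sphDist q x) =
      Real.sin (t * sphDist q x) * inner ℝ q z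
        + Real.sin ((1 - t) * sphDist q x) * inner ℝ x z := by
  rw [geo, if_neg hne, inner_add_left, real_inner_smul_left, real_inner_smul_left]
  field_simp

theorem sin_sphDist_pos {H : Type*} [NormedAddCommGroup H] [InnerProductSpace ℝ H]
    {q x : H} (hq : ‖q‖ = 1) (hx : ‖x‖ = 1) (hne : q ≠ x)
    (hd : sphDist q x < Real.pi / 2) : 0 < Real.sin (sphDist q x) := by
  apply Real.sin_pos_of_pos_of_lt_pi
  · unfold sphDist
    rw [Real.arccos_pos]
    exact inner_lt_one_iff_real_of_norm_eq_one hq hx |>.mpr hne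
  · linarith [Real.pi_pos]

theorem geo_inner_ge {H : Type*} [NormedAddCommGroup H] [InnerProductSpace ℝ H]
    {q x z : H} {t : ℝ} (ht : t ∈ Set.Icc (0 : ℝ) 1)
    (hq : ‖q‖ = 1) (hx : ‖x‖ = 1) (hd : sphDist q x < Real.pi / 2)
    (hxz : 0 ≤ (inner ℝ x z : ℝ)) (hqz : (inner ℝ x z : ℝ) ≤ inner ℝ q z) :
    inner ℝ x z * (Real.sin (t * sphDist q x) + Real.sin ((1 - t) * sphDist q x))
      ≤ inner ℝ (geo t q x) z * Real.sin (sphDist q x)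
    ∧ (inner ℝ x z : ℝ) ≤ inner ℝ (geo t q x) z := by
  by_cases hne : q = x
  · subst hne
    have h0 : sphDist q q = 0 := by
      unfold sphDist
      rw [real_inner_self_eq_norm_sq, hq]; simp
    simp [h0, geo]
  · have hs := sin_sphDist_pos hq hx hne hd
    have hD0 : 0 ≤ sphDist q x := Real.arccos_nonneg _
    have hg := geo_inner (z := z) t hne hs.ne'
    have h1 : 0 ≤ Real.sin (t * sphDist q x) :=
      Real.sin_nonneg_of_nonneg_of_le_pi (mul_nonneg ht.1 hD0)
        (by nlinarith [ht.1, ht.2, Real.pi_pos])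
    have h2 : 0 ≤ Real.sin ((1 - t) * sphDist q x) :=
      Real.sin_nonneg_of_nonneg_of_le_pi (mul_nonneg (by linarith [ht.2]) hD0)
        (by nlinarith [ht.1, ht.2, Real.pi_pos])
    have h3 : inner ℝ x z * (Real.sin (t * sphDist q x) + Real.sin ((1 - t) * sphDist q x))
        ≤ inner ℝ (geo t q x) z * Real.sin (sphDist q x) := by
      rw [hg]; nlinarith
    refine ⟨h3, ?_⟩
    have h4 : Real.sin (sphDist q x) ≤
        Real.sin (t * sphDist q x) + Real.sin ((1 - t) * sphDist q x) := by
      have : sphDist q x = t * sphDist q x + (1 - t) * sphDist q x := by ring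
      conv_lhs => rw [this, Real.sin_add]
      nlinarith [Real.cos_le_one (t * sphDist q x), Real.cos_le_one ((1 - t) * sphDist q x)]
    exact le_of_mul_le_mul_right ((mul_le_mul_of_nonneg_left h4 hxz).trans h3) hs

/-- In the CQ setting with `r ≥ 2` and `z ∈ F`, setting
`ε_n := d(T_r U_{n,r-1} x_n, x_n)` and `δ_n := d(T_{r-1} U_{n,r-2} x_n, x_n)`,
for every `n`:
`cos d(x_n,z) · sin δ_n ≥
  cos ε_n · cos d(x_n,z) · (sin(α_{n,r-1} δ_n) + sin((1-α_{n,r-1}) δ_n))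
  − sin ε_n · sin d(T_r U_{n,r-1} x_n, z) · sin δ_n`. -/
theorem cq_key_sine_inequality
    {H : Type*} [NormedAddCommGroup H] [InnerProductSpace ℝ H]
    -- `C` is a nonempty closed convex subset of the unit sphere `S_H`
    (C : Set H) (hCsphere : ∀ v ∈ C, ‖v‖ = 1)
    (hCne : C.Nonempty) (hCclosed : IsClosed C) (hCconv : SphConvex C)
    (hCdiam : ∀ v ∈ C, ∀ v' ∈ C, sphDist v v' < Real.pi / 2)
    (a : ℝ) (ha0 : 0 < a) (ha1 : a < 1 / 2)
    (r : ℕ) (hr : 1 ≤ r)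
    (α : ℕ → ℕ → ℝ)
    (hα : ∀ n, 1 ≤ n → ∀ i, 1 ≤ i → i ≤ r → α n i ∈ Set.Icc a (1 - a))
    -- `T_1, …, T_r` are nonexpansive self-mappings of `C`
    (T : ℕ → H → H)
    (hTmaps : ∀ i, 1 ≤ i → i ≤ r → ∀ v ∈ C, T i v ∈ C)
    (hTnonexp : ∀ i, 1 ≤ i → i ≤ r → ∀ v ∈ C, ∀ v' ∈ C,
      sphDist (T i v) (T i v') ≤ sphDist v v')
    -- `F := ⋂ᵢ F(Tᵢ) ≠ ∅`
    (F : Set H)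
    (hF : F = ⋂ i ∈ Finset.Icc 1 r, {z ∈ C | T i z = z})
    (hFne : F.Nonempty)
    -- the CQ iteration: `y_n = W_n x_n`, `x_{n+1} = P_{C_n ∩ Q_n} x_1`
    (x y : ℕ → H) (hx1 : x 1 ∈ C)
    (hy : ∀ n, y n = Uiter T (α n) r (x n))
    (CS QS : ℕ → Set H)
    (hCS : ∀ n, CS n = {z ∈ C | sphDist (y n) z ≤ sphDist (x n) z})
    (hQS : ∀ n, QS n = {z ∈ C |
      Real.cos (sphDist (x 1) z) ≤
        Real.cos (sphDist (x 1) (x n)) * Real.cos (sphDist (x n) z)})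
    (hxmem : ∀ n, 1 ≤ n → x (n + 1) ∈ CS n ∩ QS n)
    (hxproj : ∀ n, 1 ≤ n → ∀ z ∈ CS n ∩ QS n,
      sphDist (x 1) (x (n + 1)) ≤ sphDist (x 1) z)
    (hr2 : 2 ≤ r)
    (z : H) (hzF : z ∈ F)
    (ε δ : ℕ → ℝ)
    (hε : ∀ n, ε n = sphDist (T r (Uiter T (α n) (r - 1) (x n))) (x n))
    (hδ : ∀ n, δ n = sphDist (T (r - 1) (Uiter T (α n) (r - 2) (x n))) (x n)) :
    ∀ n, 1 ≤ n →
      Real.cos (ε n) * Real.cos (sphDist (x n) z) *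
          (Real.sin (α n (r - 1) * δ n) + Real.sin ((1 - α n (r - 1)) * δ n)) -
        Real.sin (ε n) * Real.sin (sphDist (T r (Uiter T (α n) (r - 1) (x n))) z) *
          Real.sin (δ n) ≤
      Real.cos (sphDist (x n) z) * Real.sin (δ n) := by
  intro n hn
  rw [hF] at hzF
  simp only [Set.mem_iInter, Finset.mem_Icc, Set.mem_setOf_eq] at hzF
  have hzC : z ∈ C := (hzF 1 ⟨le_refl _, hr⟩).1
  have hxC : x n ∈ C := by
    obtain ⟨m, rfl⟩ : ∃ m, n = m + 1 := ⟨n - 1, by omega⟩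
    rcases Nat.eq_zero_or_pos m with h | h
    · subst h; exact hx1
    · have := (hxmem m h).1
      rw [hCS] at this
      exact this.1
  have hα' : ∀ i, 1 ≤ i → i ≤ r → α n i ∈ Set.Icc (0 : ℝ) 1 := fun i h1 h2 =>
    ⟨ha0.le.trans (hα n hn i h1 h2).1, by linarith [(hα n hn i h1 h2).2]⟩
  have hpos : ∀ v ∈ C, 0 ≤ (inner ℝ v z : ℝ) := by
    intro v hv
    rw [← cos_sphDist (hCsphere v hv) (hCsphere z hzC)]
    exact Real.cos_nonneg_of_neg_pi_div_two_le_of_le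
      (by have : 0 ≤ sphDist v z := Real.arccos_nonneg _
          linarith [Real.pi_pos]) (hCdiam v hv z hzC).le
  have hTz : ∀ i, 1 ≤ i → i ≤ r → ∀ v ∈ C, (inner ℝ v z : ℝ) ≤ inner ℝ (T i v) z := by
    intro i h1 h2 v hv
    have h := hTnonexp i h1 h2 v hv z hzC
    rw [(hzF i ⟨h1, h2⟩).2] at h
    rw [← cos_sphDist (hCsphere v hv) (hCsphere z hzC),
      ← cos_sphDist (hCsphere _ (hTmaps i h1 h2 v hv)) (hCsphere z hzC)]
    exact Real.cos_le_cos_of_nonneg_of_le_pi (Real.arccos_nonneg _) (Real.arccos_le_pi _) h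
  have hU : ∀ i, i ≤ r → Uiter T (α n) i (x n) ∈ C ∧
      (inner ℝ (x n) z : ℝ) ≤ inner ℝ (Uiter T (α n) i (x n)) z := by
    intro i
    induction i with
    | zero => intro _; exact ⟨hxC, le_refl _⟩
    | succ k ih =>
      intro hk
      obtain ⟨h1, h2⟩ := ih (by omega)
      have hq := hTmaps (k + 1) (by omega) hk _ h1
      exact ⟨hCconv _ hq _ hxC _ (hα' (k + 1) (by omega) hk),
        (geo_inner_ge (hα' (k + 1) (by omega) hk) (hCsphere _ hq) (hCsphere _ hxC)
          (hCdiam _ hq _ hxC) (hpos _ hxC) (h2.trans (hTz (k + 1) (by omega) hk _ h1))).2⟩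
  obtain ⟨k, rfl⟩ : ∃ k, r = k + 2 := ⟨r - 2, by omega⟩
  rw [hε, hδ]
  simp only [show k + 2 - 1 = k + 1 from rfl, show k + 2 - 2 = k from rfl]
  obtain ⟨hk1, hk2⟩ := hU k (by omega)
  have huC := (hU (k + 1) (by omega)).1
  have hq := hTmaps (k + 1) (by omega) (by omega) _ hk1
  have hp := hTmaps (k + 2) (by omega) (by omega) _ huC
  have hpu := hTz (k + 2) (by omega) (by omega) _ huC
  have hg := (geo_inner_ge (hα' (k + 1) (by omega) (by omega)) (hCsphere _ hq) (hCsphere _ hxC)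
    (hCdiam _ hq _ hxC) (hpos _ hxC) (hk2.trans (hTz (k + 1) (by omega) (by omega) _ hk1))).1
  change _ ≤ inner ℝ (Uiter T (α n) (k + 1) (x n)) z * _ at hg
  have htri := sphDist_triangle_cos (hCsphere _ hp) (hCsphere _ hxC) (hCsphere _ hzC)
  rw [cos_sphDist (hCsphere _ hp) (hCsphere z hzC)] at htri
  rw [← cos_sphDist (hCsphere _ hxC) (hCsphere z hzC)] at hg
  have hcε : 0 ≤ Real.cos (sphDist (T (k + 2) (Uiter T (α n) (k + 1) (x n))) (x n)) :=
    Real.cos_nonneg_of_neg_pi_div_two_le_of_le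
      (by have : 0 ≤ sphDist (T (k + 2) (Uiter T (α n) (k + 1) (x n))) (x n) :=
            Real.arccos_nonneg _
          linarith [Real.pi_pos]) (hCdiam _ hp _ hxC).le
  have hsδ : 0 ≤ Real.sin (sphDist (T (k + 1) (Uiter T (α n) k (x n))) (x n)) :=
    Real.sin_nonneg_of_nonneg_of_le_pi (Real.arccos_nonneg _) (Real.arccos_le_pi _)
  have e1 := mul_le_mul_of_nonneg_left
    (hg.trans (mul_le_mul_of_nonneg_right hpu hsδ)) hcε
  have e2 := mul_le_mul_of_nonneg_right htri hsδ
  linarith
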